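/- arXiv:2112.07333 — 12 statements merged into one kernel-verified Lean document; each statement's English description precedes it below -/
import Mathlib

section
/- Let S be a numerical semigroup (an additive submonoid of ℕ whose complement in ℕ is finite) and let m₁, m₂ be nonzero elements of S. Then for every real number q, (q^{m₂} − 1) · ∑_{k ∈ Ap_{m₁}(S)} q^k = (q^{m₁} − 1) · ∑_{k ∈ Ap_{m₂}(S)} q^k. -/
/-- A numerical semigroup: an additive submonoid of ℕ whose complement in ℕ is finite. -/
def IsNumericalSemigroup (S : Set ℕ) : Prop :=
  0 ∈ S ∧ (∀ x ∈ S, ∀ y ∈ S, x + y ∈ S) ∧ Sᶜ.Finite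

/-- The Apéry set of `m` in `S`: elements `s ∈ S` such that `s - m ∉ S`
(as integers, i.e. either `s < m` or the natural number `s - m` is not in `S`). -/
def apery (S : Set ℕ) (m : ℕ) : Set ℕ :=
  {s ∈ S | ¬ (m ≤ s ∧ s - m ∈ S)}

/-- If `S + m ⊆ S`, the Apéry set of `m` and the gaps of `S` together are the numbers below `m`
and the gaps shifted by `m`. -/
theorem apery_union_compl {S : Set ℕ} {m : ℕ} (h : ∀ x ∈ S, x + m ∈ S) :
    apery S m ∪ Sᶜ = ↑(Finset.range m) ∪ (· + m) '' Sᶜ := by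
  ext x
  simp only [apery, Set.mem_union, Set.mem_ofPred_eq, Set.mem_compl_iff, Finset.coe_range,
    Set.mem_Iio, Set.mem_image]
  constructor
  · intro hx
    rcases lt_or_ge x m with hlt | hle
    · exact Or.inl hlt
    · refine Or.inr ⟨x - m, fun hmem => ?_, Nat.sub_add_cancel hle⟩
      have := h _ hmem
      rw [Nat.sub_add_cancel hle] at this
      tauto
  · rintro (hlt | ⟨y, hy, rfl⟩)
    · by_cases hx : x ∈ S
      · exact Or.inl ⟨hx, fun h => absurd h.1 hlt.not_ge⟩
      · exact Or.inr hx
    · by_cases hx : y + m ∈ S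
      · exact Or.inl ⟨hx, fun h => hy (by simpa using h.2)⟩
      · exact Or.inr hx

/-- The generating polynomial of an Apéry set in terms of that of the gaps. -/
theorem finsum_mem_apery_pow {R : Type*} [CommRing R] {S : Set ℕ} {m : ℕ}
    (h : ∀ x ∈ S, x + m ∈ S) (hS : Sᶜ.Finite) (q : R) :
    ∑ᶠ k ∈ apery S m, q ^ k
      = ∑ i ∈ Finset.range m, q ^ i + (q ^ m - 1) * ∑ᶠ k ∈ Sᶜ, q ^ k := by
  have hfin : (apery S m).Finite :=
    (((Finset.range m).finite_toSet.union (hS.image _)).subset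
      (apery_union_compl h ▸ Set.subset_union_left))
  have hdisj : Disjoint (apery S m) Sᶜ :=
    Set.disjoint_left.2 fun _ hx hx' => hx' hx.1
  have hdisj' : Disjoint (↑(Finset.range m) : Set ℕ) ((· + m) '' Sᶜ) := by
    refine Set.disjoint_left.2 ?_
    rintro _ hx ⟨y, -, rfl⟩
    simp at hx
  have key : ∑ᶠ k ∈ apery S m ∪ Sᶜ, q ^ k
      = ∑ᶠ k ∈ (↑(Finset.range m) ∪ (· + m) '' Sᶜ : Set ℕ), q ^ k := by
    rw [apery_union_compl h]
  rw [finsum_mem_union hdisj hfin hS,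
    finsum_mem_union hdisj' (Finset.finite_toSet _) (hS.image _), finsum_mem_coe_finset,
    finsum_mem_image (add_left_injective m).injOn] at key
  simp only [pow_add, mul_comm _ (q ^ m)] at key
  rw [← mul_finsum_mem' _ _ hS] at key
  linear_combination key

theorem stmt_0 (S : Set ℕ) (hS : IsNumericalSemigroup S)
    (m₁ m₂ : ℕ) (hm₁ : m₁ ∈ S) (hm₂ : m₂ ∈ S) (hm₁0 : m₁ ≠ 0) (hm₂0 : m₂ ≠ 0)
    (q : ℝ) :
    (q ^ m₂ - 1) * ∑ᶠ k ∈ apery S m₁, q ^ k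
      = (q ^ m₁ - 1) * ∑ᶠ k ∈ apery S m₂, q ^ k := by
  obtain ⟨-, hadd, hfin⟩ := hS
  rw [finsum_mem_apery_pow (fun x hx => hadd x hx m₁ hm₁) hfin,
    finsum_mem_apery_pow (fun x hx => hadd x hx m₂ hm₂) hfin,
    ← geom_sum_mul q m₁, ← geom_sum_mul q m₂]
  ring
end

section
/- Let a, b be coprime positive integers. Then the Apéry set of the element ab in the numerical semigroup S_{a,b} generated by a and b is Ap_{ab}(S_{a,b}) = { i·a + j·b : 0 ≤ i ≤ b−1, 0 ≤ j ≤ a−1 }. -/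
/-- The numerical semigroup generated by `a` and `b`. -/
def numSgp (a b : ℕ) : Set ℕ := {n | ∃ i j : ℕ, n = i * a + j * b}

/-- If `i * a + j * b = i' * a + j' * b + a * b` with `a, b` coprime and `i < b`, then `i ≤ i'`. -/
theorem le_of_mul_add_mul_eq_add_mul {a b i j i' j' : ℕ} (hab : Nat.Coprime a b) (hi : i < b)
    (h : i * a + j * b = i' * a + j' * b + a * b) : i ≤ i' := by
  have hmod : i * a ≡ i' * a [MOD b] := by
    have h' : (i * a + j * b) % b = (i' * a + (j' + a) * b) % b := by
      rw [h]; congr 1; ring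
    simpa [Nat.ModEq] using h'
  have hii : i ≡ i' [MOD b] := Nat.ModEq.cancel_right_of_coprime hab.symm hmod
  calc i = i % b := (Nat.mod_eq_of_lt hi).symm
    _ = i' % b := hii
    _ ≤ i' := Nat.mod_le _ _

theorem stmt_2 (a b : ℕ) (ha : 0 < a) (hb : 0 < b) (hab : Nat.Coprime a b) :
    apery (numSgp a b) (a * b)
      = {n | ∃ i j : ℕ, i ≤ b - 1 ∧ j ≤ a - 1 ∧ n = i * a + j * b} := by
  ext n
  constructor
  · rintro ⟨⟨i, j, rfl⟩, hn⟩
    refine ⟨i, j, ?_, ?_, rfl⟩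
    · by_contra hi
      obtain ⟨k, rfl⟩ := Nat.exists_eq_add_of_le (show b ≤ i by omega)
      have h : (b + k) * a + j * b = a * b + (k * a + j * b) := by ring
      exact hn ⟨by omega, k, j, by omega⟩
    · by_contra hj
      obtain ⟨k, rfl⟩ := Nat.exists_eq_add_of_le (show a ≤ j by omega)
      have h : i * a + (a + k) * b = a * b + (i * a + k * b) := by ring
      exact hn ⟨by omega, i, k, by omega⟩
  · rintro ⟨i, j, hi, hj, rfl⟩
    refine ⟨⟨i, j, rfl⟩, ?_⟩
    rintro ⟨hle, i', j', h⟩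
    have h' : i * a + j * b = i' * a + j' * b + a * b := by omega
    have hii : i ≤ i' := le_of_mul_add_mul_eq_add_mul hab (by omega) h'
    have hjj : j ≤ j' :=
      le_of_mul_add_mul_eq_add_mul (j := i) (j' := i') hab.symm (by omega) (by linarith)
    have hab_pos : 0 < a * b := Nat.mul_pos ha hb
    have hia : i * a ≤ i' * a := Nat.mul_le_mul_right a hii
    have hjb : j * b ≤ j' * b := Nat.mul_le_mul_right b hjj
    omega
end

section
/- Let a, b be coprime positive integers and let n ≥ 1. Then { k + (n−1)·a·b : k ∈ Ap_{ab}(S_{a,b}) } = R_n(a,b), where R_n(a,b) is the set of natural numbers m having exactly n representations m = i·a + j·b with i, j ∈ ℕ. -/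
/-- `R n a b` is the set of natural numbers having exactly `n` representations
`m = i*a + j*b` with `i, j ∈ ℕ`. -/
def R (n a b : ℕ) : Set ℕ :=
  {m | {p : ℕ × ℕ | p.1 * a + p.2 * b = m}.ncard = n}

/-- The pairs `(i, j)` with `i * a + j * b = m`. -/
def reps (a b m : ℕ) : Set (ℕ × ℕ) := {p | p.1 * a + p.2 * b = m}

theorem reps_finite {a b : ℕ} (ha : 0 < a) (hb : 0 < b) (m : ℕ) : (reps a b m).Finite := by
  refine (Set.finite_Iic (m, m)).subset fun p hp => ?_
  have hp' : p.1 * a + p.2 * b = m := hp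
  exact ⟨by nlinarith [Nat.zero_le (p.2 * b)], by nlinarith [Nat.zero_le (p.1 * a)]⟩

theorem ncard_reps_eq_zero_iff {a b : ℕ} (ha : 0 < a) (hb : 0 < b) (m : ℕ) :
    (reps a b m).ncard = 0 ↔ m ∉ numSgp a b := by
  rw [Set.ncard_eq_zero (reps_finite ha hb m), ← Set.not_nonempty_iff_eq_empty, not_iff_not]
  exact ⟨fun ⟨p, hp⟩ => ⟨p.1, p.2, hp.symm⟩, fun ⟨i, j, h⟩ => ⟨(i, j), h.symm⟩⟩

theorem eq_of_mem_reps {a b m : ℕ} (hb : 0 < b) (hab : Nat.Coprime a b) {p q : ℕ × ℕ}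
    (hp : p ∈ reps a b m) (hq : q ∈ reps a b m) (hpb : p.1 < b) (hqb : q.1 < b) : p = q := by
  have h : p.1 * a + p.2 * b = q.1 * a + q.2 * b := Eq.trans hp (Eq.symm hq)
  have hmod : p.1 * a ≡ q.1 * a [MOD b] := by
    simpa [Nat.ModEq] using congrArg (· % b) h
  have h₁ : p.1 = q.1 :=
    (Nat.ModEq.cancel_right_of_coprime hab.symm hmod).eq_of_lt_of_lt hpb hqb
  rw [h₁] at h
  exact Prod.ext h₁ (Nat.eq_of_mul_eq_mul_right hb (Nat.add_left_cancel h))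

theorem ncard_reps_le_one {a b m : ℕ} (hb : 0 < b) (hab : Nat.Coprime a b)
    (hm : m < a * b) : (reps a b m).ncard ≤ 1 := by
  have hlt : ∀ p ∈ reps a b m, p.1 < b := fun p hp => by
    have hp' : p.1 * a + p.2 * b = m := hp
    by_contra! h
    nlinarith [Nat.mul_le_mul_right a h]
  have hsub : (reps a b m).Subsingleton := fun p hp q hq =>
    eq_of_mem_reps hb hab hp hq (hlt p hp) (hlt q hq)
  rcases hsub.eq_empty_or_singleton with h | ⟨p, h⟩ <;> simp [h]

theorem exists_mem_reps_lt {a b m : ℕ} (hb : 0 < b) (hab : Nat.Coprime a b)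
    (hm : a * b ≤ m) : ∃ p ∈ reps a b m, p.1 < b := by
  obtain ⟨c, hlt, hc⟩ := Nat.exists_mul_mod_eq_of_coprime m hab hb.ne'
  have hle : c * a ≤ m := by nlinarith [Nat.mul_le_mul_right a hlt.le]
  have hmod : c * a ≡ m [MOD b] := by
    rw [mul_comm]
    exact hc
  obtain ⟨j, hj⟩ := (Nat.modEq_iff_dvd' hle).1 hmod
  refine ⟨(c, j), ?_, hlt⟩
  change c * a + j * b = m
  rw [mul_comm j]
  omega

theorem ncard_reps_add_mul {a b : ℕ} (ha : 0 < a) (hb : 0 < b) (hab : Nat.Coprime a b) (m : ℕ) :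
    (reps a b (m + a * b)).ncard = (reps a b m).ncard + 1 := by
  obtain ⟨p, hp, hpb⟩ := exists_mem_reps_lt hb hab (Nat.le_add_left (a * b) m)
  set f : ℕ × ℕ → ℕ × ℕ := fun q => (q.1 + b, q.2) with hf
  have hinj : Function.Injective f := fun q r h => by
    simp only [hf, Prod.mk.injEq, Nat.add_right_cancel_iff] at h
    exact Prod.ext h.1 h.2
  have hset : reps a b (m + a * b) = insert p (f '' reps a b m) := by
    ext q
    constructor
    · intro hq
      rcases lt_or_ge q.1 b with h | h
      · exact Or.inl (eq_of_mem_reps hb hab hq hp h hpb)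
      · obtain ⟨i, hi⟩ := Nat.exists_eq_add_of_le' h
        refine Or.inr ⟨(i, q.2), ?_, Prod.ext hi.symm rfl⟩
        have hq' : q.1 * a + q.2 * b = m + a * b := hq
        change i * a + q.2 * b = m
        rw [hi] at hq'
        linarith
    · rintro (rfl | ⟨r, hr, rfl⟩)
      · exact hp
      · have hr' : r.1 * a + r.2 * b = m := hr
        change (r.1 + b) * a + r.2 * b = m + a * b
        linarith
  have hnot : p ∉ f '' reps a b m := by
    rintro ⟨r, -, rfl⟩
    exact absurd hpb (Nat.not_lt.2 (Nat.le_add_left b r.1))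
  rw [hset, Set.ncard_insert_of_notMem hnot ((reps_finite ha hb m).image f),
    Set.ncard_image_of_injective _ hinj]

theorem ncard_reps_add_mul_mul {a b : ℕ} (ha : 0 < a) (hb : 0 < b) (hab : Nat.Coprime a b)
    (m t : ℕ) : (reps a b (m + t * (a * b))).ncard = (reps a b m).ncard + t := by
  induction t with
  | zero => simp
  | succ t ih => rw [Nat.succ_mul, ← add_assoc, ncard_reps_add_mul ha hb hab, ih, add_assoc]

theorem mem_apery_iff_ncard_reps {a b : ℕ} (ha : 0 < a) (hb : 0 < b) (hab : Nat.Coprime a b)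
    (k : ℕ) : k ∈ apery (numSgp a b) (a * b) ↔ (reps a b k).ncard = 1 := by
  have hk := ncard_reps_eq_zero_iff ha hb k
  change k ∈ numSgp a b ∧ ¬(a * b ≤ k ∧ k - a * b ∈ numSgp a b) ↔ _
  rcases lt_or_ge k (a * b) with h | h
  · have := ncard_reps_le_one hb hab h
    have := Nat.not_le.2 h
    grind
  · obtain ⟨l, rfl⟩ := Nat.exists_eq_add_of_le' h
    have := ncard_reps_eq_zero_iff ha hb l
    have := ncard_reps_add_mul ha hb hab l
    rw [Nat.add_sub_cancel]
    grind

theorem stmt_3 (a b n : ℕ) (ha : 0 < a) (hb : 0 < b) (hab : Nat.Coprime a b)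
    (hn : 1 ≤ n) :
    (fun k => k + (n - 1) * (a * b)) '' apery (numSgp a b) (a * b) = R n a b := by
  ext m
  change _ ↔ (reps a b m).ncard = n
  constructor
  · rintro ⟨k, hk, rfl⟩
    rw [mem_apery_iff_ncard_reps ha hb hab] at hk
    rw [ncard_reps_add_mul_mul ha hb hab, hk]
    omega
  · intro hm
    have hdiv : m % (a * b) + m / (a * b) * (a * b) = m := Nat.mod_add_div' m (a * b)
    have hcard := ncard_reps_add_mul_mul ha hb hab (m % (a * b)) (m / (a * b))
    have hle := ncard_reps_le_one hb hab (Nat.mod_lt m (Nat.mul_pos ha hb))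
    rw [hdiv, hm] at hcard
    have hmul : (n - 1) * (a * b) ≤ m :=
      (Nat.mul_le_mul_right _ (by omega)).trans (Nat.div_mul_le_self m (a * b))
    obtain ⟨k, rfl⟩ := Nat.exists_eq_add_of_le' hmul
    refine ⟨k, (mem_apery_iff_ncard_reps ha hb hab k).2 ?_, rfl⟩
    rw [ncard_reps_add_mul_mul ha hb hab] at hm
    omega
end

section
/- (Gassert–Shor formula) Let S be a numerical semigroup, m a nonzero element of S, and f : ℕ → ℝ any function. Then ∑_{k ∈ ℕ \ S} (f(k+m) − f(k)) = ∑_{k ∈ Ap_m(S)} f(k) − ∑_{k=0}^{m−1} f(k). -/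
/-- A natural number is below `m` or a gap shifted by `m` if and only if it lies in the Apéry set
or is a gap. -/
theorem IsNumericalSemigroup.image_add_compl_union_Iio {S : Set ℕ} (hS : IsNumericalSemigroup S)
    {m : ℕ} (hm : m ∈ S) :
    (fun k => k + m) '' Sᶜ ∪ Set.Iio m = apery S m ∪ Sᶜ := by
  ext n
  simp only [apery, Set.mem_union, Set.mem_image, Set.mem_compl_iff, Set.mem_Iio, Set.mem_ofPred_eq]
  constructor
  · rintro (⟨k, hk, rfl⟩ | hn)
    · by_cases h : k + m ∈ S
      · exact Or.inl ⟨h, by simpa using hk⟩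
      · exact Or.inr h
    · by_cases h : n ∈ S
      · exact Or.inl ⟨h, fun h' => absurd h'.1 (by omega)⟩
      · exact Or.inr h
  · intro h
    by_cases hn : n < m
    · exact Or.inr hn
    · refine Or.inl ⟨n - m, fun h' => ?_, by omega⟩
      rcases h with ⟨-, h⟩ | h
      · exact h ⟨by omega, h'⟩
      · apply h
        have := hS.2.1 _ h' _ hm
        rwa [Nat.sub_add_cancel (by omega)] at this

/-- Gassert–Shor formula. -/
theorem stmt_4 (S : Set ℕ) (hS : IsNumericalSemigroup S)
    (m : ℕ) (hm : m ∈ S) (hm0 : m ≠ 0) (f : ℕ → ℝ) :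
    ∑ᶠ k ∈ Sᶜ, (f (k + m) - f k)
      = (∑ᶠ k ∈ apery S m, f k) - ∑ k ∈ Finset.range m, f k := by
  have hG : Sᶜ.Finite := hS.2.2
  have hU := hS.image_add_compl_union_Iio hm
  have hA : (apery S m).Finite :=
    ((hG.image fun k => k + m).union (Set.finite_Iio m)).subset
      (hU ▸ Set.subset_union_left)
  have hshift : ∑ᶠ k ∈ (fun k => k + m) '' Sᶜ, f k = ∑ᶠ k ∈ Sᶜ, f (k + m) :=
    finsum_mem_image (add_left_injective m).injOn
  have hrange : ∑ᶠ k ∈ Set.Iio m, f k = ∑ k ∈ Finset.range m, f k := by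
    rw [← finsum_mem_coe_finset, Finset.coe_range]
  have hleft := finsum_mem_union (f := f)
    (show Disjoint ((fun k => k + m) '' Sᶜ) (Set.Iio m) by
      rw [Set.disjoint_left]
      rintro _ ⟨k, -, rfl⟩ h
      simp at h) (hG.image _) (Set.finite_Iio m)
  have hright := finsum_mem_union (f := f)
    (show Disjoint (apery S m) Sᶜ from Set.disjoint_left.2 fun _ h h' => h' h.1) hA hG
  rw [hU] at hleft
  rw [finsum_mem_sub_distrib _ _ hG, ← hshift, ← hrange]
  linarith
end

section
/- (Mordell formula) Let a, b be coprime positive integers and let f : ℕ → ℝ be any function. Then ∑_{k ∈ C_{a,b}} (f(k + ab) − f(k)) = ∑_{i=0}^{b−1} ∑_{j=0}^{a−1} f(i·a + j·b) − ∑_{k=0}^{ab−1} f(k). -/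
/-- The set of gaps of the numerical semigroup generated by `a` and `b`. -/
def gaps (a b : ℕ) : Set ℕ := (numSgp a b)ᶜ

theorem mem_numSgp_of_mul_le {a b n : ℕ} (ha : 0 < a) (hb : 0 < b) (hab : Nat.Coprime a b)
    (hn : a * b ≤ n) : n ∈ numSgp a b := by
  obtain ⟨k, hka, hkb⟩ := Nat.chineseRemainder hab 0 n
  have hdvd : a ∣ k % (a * b) :=
    (Nat.dvd_mod_iff (Dvd.intro _ rfl)).2 ((Nat.modEq_zero_iff_dvd).1 hka)
  have hlt : k % (a * b) < a * b := Nat.mod_lt _ (Nat.mul_pos ha hb)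
  have hmod : k % (a * b) ≡ n [MOD b] :=
    ((Nat.mod_modEq k (a * b)).of_mul_left a).trans hkb
  obtain ⟨i, hi⟩ := hdvd
  obtain ⟨j, hj⟩ := (Nat.modEq_iff_dvd' (hlt.le.trans hn)).1 hmod
  refine ⟨i, j, ?_⟩
  rw [mul_comm i a, mul_comm j b, ← hi, ← hj]
  omega

theorem le_of_mul_add_mul_eq {a b i j i' j' : ℕ} (hab : Nat.Coprime a b) (hi : i < b)
    (h : i' * a + j' * b = i * a + j * b) : i ≤ i' := by
  have h1 : i' * a ≡ i * a [MOD b] := by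
    have : (i' * a + j' * b) % b = (i * a + j * b) % b := by rw [h]
    simpa [Nat.ModEq] using this
  have h2 : i' ≡ i [MOD b] :=
    Nat.ModEq.cancel_right_of_coprime (by rwa [Nat.gcd_comm] : Nat.gcd b a = 1) h1
  calc i = i % b := (Nat.mod_eq_of_lt hi).symm
    _ = i' % b := h2.symm
    _ ≤ i' := Nat.mod_le _ _

theorem injOn_mul_add_mul {a b : ℕ} (hb : 0 < b) (hab : Nat.Coprime a b) :
    Set.InjOn (fun p : ℕ × ℕ => p.1 * a + p.2 * b)
      (Finset.range b ×ˢ Finset.range a : Finset (ℕ × ℕ)) := by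
  rintro ⟨i, j⟩ hp ⟨i', j'⟩ hq h
  simp only [Finset.coe_product, Finset.coe_range, Set.mem_prod, Set.mem_Iio] at hp hq h
  obtain rfl : i = i' :=
    le_antisymm (le_of_mul_add_mul_eq hab hp.1 h.symm) (le_of_mul_add_mul_eq hab hq.1 h)
  have : j * b = j' * b := by omega
  rw [Nat.eq_of_mul_eq_mul_right hb this]

theorem exists_lt_of_mem_numSgp {a b n : ℕ} (hb : 0 < b) (hn : n ∈ numSgp a b) :
    ∃ i j : ℕ, i < b ∧ n = i * a + j * b := by
  obtain ⟨i, j, rfl⟩ := hn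
  refine ⟨i % b, j + i / b * a, Nat.mod_lt _ hb, ?_⟩
  conv_lhs => rw [← Nat.mod_add_div i b]
  ring

open Classical in
theorem image_mul_add_mul_eq {a b : ℕ} (ha : 0 < a) (hb : 0 < b) (hab : Nat.Coprime a b) :
    (Finset.range b ×ˢ Finset.range a).image (fun p : ℕ × ℕ => p.1 * a + p.2 * b)
      = (Finset.range (a * b)).filter (fun n => ¬ n ∈ gaps a b) ∪
        ((Finset.range (a * b)).filter (fun n => n ∈ gaps a b)).image (fun k => k + a * b) := by
  ext n
  simp only [Finset.mem_image, Finset.mem_product, Finset.mem_range, Finset.mem_union,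
    Finset.mem_filter, Prod.exists, gaps, Set.mem_compl_iff, not_not]
  constructor
  · rintro ⟨i, j, ⟨hi, hj⟩, rfl⟩
    by_cases hlt : i * a + j * b < a * b
    · exact Or.inl ⟨hlt, i, j, rfl⟩
    · refine Or.inr ⟨i * a + j * b - a * b, ⟨?_, ?_⟩, by omega⟩
      · have h1 : i * a < b * a := Nat.mul_lt_mul_of_pos_right hi ha
        have h2 : j * b < a * b := Nat.mul_lt_mul_of_pos_right hj hb
        rw [mul_comm b a] at h1
        omega
      · rintro ⟨i', j', h⟩
        have h3 : i' * a + (j' + a) * b = i * a + j * b := by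
          rw [add_mul]; omega
        have h4 := Nat.mul_le_mul_right a (le_of_mul_add_mul_eq hab hi h3)
        have h5 : j * b < (j' + a) * b := Nat.mul_lt_mul_of_pos_right (by omega) hb
        omega
  · intro h
    have hn : n ∈ numSgp a b := by
      rcases h with h | ⟨k, -, rfl⟩
      · exact h.2
      · exact mem_numSgp_of_mul_le ha hb hab (by omega)
    obtain ⟨i, j, hi, rfl⟩ := exists_lt_of_mem_numSgp hb hn
    refine ⟨i, j, ⟨hi, ?_⟩, rfl⟩
    by_contra! hj
    obtain ⟨c, rfl⟩ := Nat.exists_eq_add_of_le hj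
    rw [add_mul] at h
    rcases h with h | ⟨k, hk, h⟩
    · omega
    · exact hk.2 ⟨i, c, by omega⟩

/-- Mordell formula. -/
theorem stmt_5 (a b : ℕ) (ha : 0 < a) (hb : 0 < b) (hab : Nat.Coprime a b)
    (f : ℕ → ℝ) :
    ∑ᶠ k ∈ gaps a b, (f (k + a * b) - f k)
      = (∑ i ∈ Finset.range b, ∑ j ∈ Finset.range a, f (i * a + j * b))
        - ∑ k ∈ Finset.range (a * b), f k := by
  classical
  have hG : gaps a b = ((Finset.range (a * b)).filter (fun n => n ∈ gaps a b) : Finset ℕ) := by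
    ext n
    simp only [Finset.coe_filter, Finset.mem_range, Set.mem_ofPred_eq, iff_and_self]
    intro hn
    by_contra! h
    exact hn (mem_numSgp_of_mul_le ha hb hab h)
  have hdisj : Disjoint ((Finset.range (a * b)).filter (fun n => ¬ n ∈ gaps a b))
      (((Finset.range (a * b)).filter (fun n => n ∈ gaps a b)).image (fun k => k + a * b)) := by
    rw [Finset.disjoint_left]
    intro n hn hn'
    simp only [Finset.mem_image, Finset.mem_filter, Finset.mem_range] at hn hn'
    obtain ⟨k, -, rfl⟩ := hn'
    omega
  have hsum : ∑ᶠ k ∈ gaps a b, (f (k + a * b) - f k)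
      = ∑ k ∈ (Finset.range (a * b)).filter (fun n => n ∈ gaps a b), (f (k + a * b) - f k) := by
    rw [← finsum_mem_coe_finset, ← hG]
  rw [hsum, ← Finset.sum_product' (Finset.range b) (Finset.range a)
      (fun i j => f (i * a + j * b)),
    ← Finset.sum_image (f := f) (injOn_mul_add_mul hb hab), image_mul_add_mul_eq ha hb hab,
    Finset.sum_union hdisj, Finset.sum_image (fun _ _ _ _ h => Nat.add_right_cancel h),
    ← Finset.sum_filter_add_sum_filter_not (Finset.range (a * b)) (fun n => n ∈ gaps a b) f,
    Finset.sum_sub_distrib]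
  ring
end

section
/- (Tuenter formula) Let a, b be coprime positive integers and let f : ℕ → ℝ be any function. Then ∑_{k ∈ C_{a,b}} (f(k + b) − f(k)) = ∑_{k=0}^{b−1} (f(a·k) − f(k)). -/
open Finset in
/-- Multiplication by `a` permutes the residues modulo `b` when `a` and `b` are coprime. -/
theorem injOn_mul_mod_range {a b : ℕ} (hab : Nat.Coprime a b) :
    Set.InjOn (fun k => a * k % b) (range b) := by
  intro k hk l hl h
  have hkl : k ≡ l [MOD b] := Nat.ModEq.cancel_left_of_coprime hab.symm h
  exact hkl.eq_of_lt_of_lt (by simpa using hk) (by simpa using hl)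

open Finset in
theorem image_mul_mod_range {a b : ℕ} (hb : 0 < b) (hab : Nat.Coprime a b) :
    (range b).image (fun k => a * k % b) = range b := by
  refine eq_of_subset_of_card_le ?_ (card_image_of_injOn (injOn_mul_mod_range hab)).ge
  intro x hx
  obtain ⟨k, -, rfl⟩ := mem_image.1 hx
  exact mem_range.2 (Nat.mod_lt _ hb)

/-- In the residue class of `a * k` with `k < b`, the semigroup consists of the elements that are
at least `a * k`. -/
theorem mem_numSgp_iff_le {a b k n : ℕ} (hab : Nat.Coprime a b) (hk : k < b)
    (h : n ≡ a * k [MOD b]) : n ∈ numSgp a b ↔ a * k ≤ n := by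
  constructor
  · rintro ⟨i, j, rfl⟩
    have hik : a * i ≡ a * k [MOD b] := by
      simpa [Nat.ModEq, mul_comm i a] using h
    have hki : i % b = k := by
      have := Nat.ModEq.cancel_left_of_coprime hab.symm hik
      rwa [Nat.ModEq, Nat.mod_eq_of_lt hk] at this
    have : a * k ≤ a * i := Nat.mul_le_mul_left a (hki ▸ Nat.mod_le i b)
    linarith [Nat.zero_le (j * b), mul_comm i a]
  · intro hle
    obtain ⟨j, hj⟩ := (Nat.modEq_iff_dvd' hle).1 h.symm
    exact ⟨k, j, by rw [mul_comm k a, mul_comm j b, ← hj]; omega⟩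

open Finset in
theorem gaps_eq_image {a b : ℕ} (hb : 0 < b) (hab : Nat.Coprime a b) :
    gaps a b = ↑(((range b).sigma fun k => range (a * k / b)).image
      fun p => a * p.1 % b + b * p.2) := by
  ext n
  simp only [gaps, Set.mem_compl_iff, coe_image, Set.mem_image, mem_coe, mem_sigma, mem_range,
    Sigma.exists]
  constructor
  · intro hn
    have hmem : n % b ∈ (range b).image (fun k => a * k % b) := by
      rw [image_mul_mod_range hb hab]
      exact mem_range.2 (Nat.mod_lt _ hb)
    obtain ⟨k, hk, hkn⟩ := mem_image.1 hmem
    rw [mem_range] at hk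
    rw [mem_numSgp_iff_le hab hk hkn.symm, not_le] at hn
    refine ⟨k, n / b, ⟨hk, ?_⟩, by rw [hkn, Nat.mod_add_div]⟩
    by_contra! hle
    have := Nat.mul_le_mul_left b hle
    have h1 := Nat.mod_add_div n b
    have h2 := Nat.mod_add_div (a * k) b
    omega
  · rintro ⟨k, j, ⟨hk, hj⟩, rfl⟩
    rw [mem_numSgp_iff_le hab hk (by simp [Nat.ModEq]), not_le]
    have := Nat.mul_lt_mul_of_pos_left hj hb
    have h2 := Nat.mod_add_div (a * k) b
    omega

open Finset in
theorem injOn_mul_mod_add {a b : ℕ} (hb : 0 < b) (hab : Nat.Coprime a b) :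
    Set.InjOn (fun p : (_ : ℕ) × ℕ => a * p.1 % b + b * p.2)
      ((range b).sigma fun k => range (a * k / b)) := by
  rintro ⟨k, i⟩ hk ⟨l, j⟩ hl h
  simp only [mem_coe, mem_sigma] at hk hl h
  have hkl : k = l := injOn_mul_mod_range hab hk.1 hl.1 (by simpa using congrArg (· % b) h)
  subst hkl
  have hij : i = j := Nat.eq_of_mul_eq_mul_left hb (Nat.add_left_cancel h)
  rw [hij]

/-- Tuenter formula. -/
theorem stmt_6 (a b : ℕ) (ha : 0 < a) (hb : 0 < b) (hab : Nat.Coprime a b)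
    (f : ℕ → ℝ) :
    ∑ᶠ k ∈ gaps a b, (f (k + b) - f k)
      = ∑ k ∈ Finset.range b, (f (a * k) - f k) := by
  rw [gaps_eq_image hb hab, finsum_mem_coe_finset, Finset.sum_image (injOn_mul_mod_add hb hab),
    Finset.sum_sigma]
  have telescope (k : ℕ) : ∑ j ∈ Finset.range (a * k / b),
      (f (a * k % b + b * j + b) - f (a * k % b + b * j)) = f (a * k) - f (a * k % b) := by
    simpa [mul_add, add_assoc, Nat.mod_add_div] using
      Finset.sum_range_sub (fun j => f (a * k % b + b * j)) (a * k / b)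
  simp only [telescope, Finset.sum_sub_distrib]
  rw [← Finset.sum_image (f := f) (injOn_mul_mod_range hab), image_mul_mod_range hb hab]
end

section
/- Let a, b be coprime positive integers, f : ℝ → ℝ a function, and α_a, β_a, α_b, β_b real numbers such that f(i·a/b) = α_a · ∑_{j=0}^{a−1} f(i/b + j/a) + β_a for every i ∈ {0, …, b−1}, and f(j·b/a) = α_b · ∑_{i=0}^{b−1} f(i/b + j/a) + β_b for every j ∈ {0, …, a−1}. Then α_b · ∑_{i=0}^{b−1} (i/b) f(i·a/b) + α_a · ∑_{j=0}^{a−1} (j/a) f(j·b/a) = α_a α_b · ∑_{k ∈ C_{a,b}} ( (k/(ab) + 1) f(k/(ab) + 1) − (k/(ab)) f(k/(ab)) ) + α_a α_b · ∑_{k=0}^{ab−1} (k/(ab)) f(k/(ab)) + α_b β_a (b−1)/2 + α_a β_b (a−1)/2. -/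
theorem Nat.Coprime.modEq_of_combo_modEq {a b i j i' j' : ℕ} (hab : Nat.Coprime a b)
    (h : i * a + j * b ≡ i' * a + j' * b [MOD a * b]) :
    i ≡ i' [MOD b] ∧ j ≡ j' [MOD a] := by
  constructor
  · have h1 : i * a + j * b ≡ i' * a + j' * b [MOD b] := h.of_mul_left a
    have h2 : i * a ≡ i' * a [MOD b] := by simpa [Nat.ModEq] using h1
    exact Nat.ModEq.cancel_right_of_coprime hab.symm h2
  · have h1 : i * a + j * b ≡ i' * a + j' * b [MOD a] := h.of_mul_right b
    have h2 : j * b ≡ j' * b [MOD a] := by simpa [Nat.ModEq] using h1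
    exact Nat.ModEq.cancel_right_of_coprime hab h2

/-- The combinations `i * a + j * b` with `i < b`, `j < a` are distinct modulo `a * b`. -/
theorem injOn_combo_mod {a b : ℕ} (hab : Nat.Coprime a b) :
    Set.InjOn (fun p : ℕ × ℕ => (p.1 * a + p.2 * b) % (a * b))
      (Finset.range b ×ˢ Finset.range a : Finset (ℕ × ℕ)) := by
  rintro ⟨i, j⟩ hp ⟨i', j'⟩ hq h
  simp only [Finset.coe_product, Set.mem_prod, Finset.mem_coe, Finset.mem_range] at hp hq
  obtain ⟨h1, h2⟩ := hab.modEq_of_combo_modEq h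
  exact Prod.ext (h1.eq_of_lt_of_lt hp.1 hq.1) (h2.eq_of_lt_of_lt hp.2 hq.2)

/-- The combinations `i * a + j * b` with `i < b`, `j < a` represent every residue
modulo `a * b`. -/
theorem image_combo_mod {a b : ℕ} (ha : 0 < a) (hb : 0 < b) (hab : Nat.Coprime a b) :
    (Finset.range b ×ˢ Finset.range a).image (fun p : ℕ × ℕ => (p.1 * a + p.2 * b) % (a * b))
      = Finset.range (a * b) := by
  apply Finset.eq_of_subset_of_card_le
  · intro n hn
    obtain ⟨p, -, rfl⟩ := Finset.mem_image.1 hn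
    exact Finset.mem_range.2 (Nat.mod_lt _ (Nat.mul_pos ha hb))
  · rw [Finset.card_image_of_injOn (injOn_combo_mod hab)]
    simp [mul_comm]

theorem combo_mod_of_lt {a b i j : ℕ} (h : i * a + j * b < a * b) :
    (i * a + j * b) % (a * b) = i * a + j * b ∧ (i * a + j * b) % (a * b) ∈ numSgp a b := by
  rw [Nat.mod_eq_of_lt h]
  exact ⟨rfl, i, j, rfl⟩

theorem combo_mod_of_le {a b i j : ℕ} (hab : Nat.Coprime a b)
    (hi : i < b) (hj : j < a) (h : a * b ≤ i * a + j * b) :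
    (i * a + j * b) % (a * b) + a * b = i * a + j * b ∧
      (i * a + j * b) % (a * b) ∉ numSgp a b := by
  have hia : i * a < a * b := by nlinarith
  have hjb : j * b < a * b := by nlinarith
  have hmod : (i * a + j * b) % (a * b) = i * a + j * b - a * b := by
    rw [Nat.mod_eq_sub_mod h, Nat.mod_eq_of_lt (by omega)]
  refine ⟨by omega, ?_⟩
  rintro ⟨i', j', h'⟩
  obtain ⟨h1, h2⟩ : i ≡ i' [MOD b] ∧ j ≡ j' [MOD a] := by
    apply hab.modEq_of_combo_modEq
    rw [← h']
    exact (Nat.mod_modEq _ _).symm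
  have hi' : i ≤ i' := by
    rw [← Nat.mod_eq_of_lt hi, h1]
    exact Nat.mod_le _ _
  have hj' : j ≤ j' := by
    rw [← Nat.mod_eq_of_lt hj, h2]
    exact Nat.mod_le _ _
  have := Nat.mul_le_mul_right a hi'
  have := Nat.mul_le_mul_right b hj'
  omega

theorem lt_of_mem_gaps {a b k : ℕ} (ha : 0 < a) (hb : 0 < b) (hab : Nat.Coprime a b)
    (hk : k ∈ gaps a b) : k < a * b := by
  by_contra! hle
  apply hk
  have hmem := Finset.mem_range.2 (Nat.mod_lt k (Nat.mul_pos ha hb))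
  rw [← image_combo_mod ha hb hab] at hmem
  obtain ⟨⟨i, j⟩, hp, h⟩ := Finset.mem_image.1 hmem
  simp only [Finset.mem_product, Finset.mem_range] at hp h
  have hdiv := Nat.mod_add_div k (a * b)
  have hq : 0 < k / (a * b) := Nat.div_pos hle (Nat.mul_pos ha hb)
  obtain ⟨q, hq'⟩ : ∃ q, k / (a * b) = q + 1 := ⟨_, (Nat.succ_pred_eq_of_pos hq).symm⟩
  rw [hq'] at hdiv
  rcases lt_or_ge (i * a + j * b) (a * b) with hlt | hge
  · have := (combo_mod_of_lt hlt).1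
    refine ⟨i + b * (q + 1), j, ?_⟩
    rw [← hdiv, ← h, this]
    ring
  · have := (combo_mod_of_le hab hp.1 hp.2 hge).1
    refine ⟨i + b * q, j, ?_⟩
    rw [← hdiv, ← h]
    linear_combination this

/-- Summing over the combinations `i * a + j * b` with `i < b`, `j < a` amounts to summing over
`k < a * b` with every gap `k` replaced by `k + a * b`. -/
theorem sum_combo_eq_sum_add_finsum_gaps {M : Type*} [AddCommGroup M] {a b : ℕ} (ha : 0 < a)
    (hb : 0 < b) (hab : Nat.Coprime a b) (F : ℕ → M) :
    ∑ i ∈ Finset.range b, ∑ j ∈ Finset.range a, F (i * a + j * b)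
      = (∑ᶠ k ∈ gaps a b, (F (k + a * b) - F k)) + ∑ k ∈ Finset.range (a * b), F k := by
  classical
  have hgaps : gaps a b = ↑((Finset.range (a * b)).filter (fun k => k ∉ numSgp a b)) := by
    ext k
    simp only [Finset.coe_filter, Finset.mem_range, Set.mem_ofPred_eq]
    exact ⟨fun hk => ⟨lt_of_mem_gaps ha hb hab hk, hk⟩, fun hk => hk.2⟩
  rw [hgaps, finsum_mem_coe_finset, Finset.sum_filter, ← Finset.sum_add_distrib,
    ← Finset.sum_product', ← image_combo_mod ha hb hab,
    Finset.sum_image (injOn_combo_mod hab)]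
  refine Finset.sum_congr rfl ?_
  rintro ⟨i, j⟩ hp
  simp only [Finset.mem_product, Finset.mem_range] at hp
  rcases lt_or_ge (i * a + j * b) (a * b) with hlt | hge
  · obtain ⟨h1, h2⟩ := combo_mod_of_lt hlt
    rw [if_neg (not_not.2 h2), h1, zero_add]
  · obtain ⟨h1, h2⟩ := combo_mod_of_le hab hp.1 hp.2 hge
    rw [if_pos h2, h1, sub_add_cancel]

theorem sum_range_cast_div {n : ℕ} (hn : 0 < n) :
    ∑ i ∈ Finset.range n, (i / n : ℝ) = (n - 1) / 2 := by
  have hn' : (n : ℝ) ≠ 0 := by positivity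
  have key : ∀ m : ℕ, ∑ i ∈ Finset.range m, (i : ℝ) = m * (m - 1) / 2 := by
    intro m
    induction m with
    | zero => simp
    | succ m ih => rw [Finset.sum_range_succ, ih]; push_cast; ring
  rw [← Finset.sum_div, key]
  field_simp

theorem stmt_8 (a b : ℕ) (ha : 0 < a) (hb : 0 < b) (hab : Nat.Coprime a b)
    (f : ℝ → ℝ) (αa βa αb βb : ℝ)
    (hfa : ∀ i ∈ Finset.range b,
      f (i * a / b) = αa * (∑ j ∈ Finset.range a, f (i / b + j / a)) + βa)
    (hfb : ∀ j ∈ Finset.range a,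
      f (j * b / a) = αb * (∑ i ∈ Finset.range b, f (i / b + j / a)) + βb) :
    αb * (∑ i ∈ Finset.range b, (i / b : ℝ) * f (i * a / b))
      + αa * (∑ j ∈ Finset.range a, (j / a : ℝ) * f (j * b / a))
      = αa * αb * (∑ᶠ k ∈ gaps a b,
            ((k / (a * b) + 1) * f (k / (a * b) + 1) - k / (a * b) * f (k / (a * b))))
        + αa * αb * (∑ k ∈ Finset.range (a * b), (k / (a * b) : ℝ) * f (k / (a * b)))
        + αb * βa * (b - 1) / 2 + αa * βb * (a - 1) / 2 := by
  have ha' : (a : ℝ) ≠ 0 := by positivity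
  have hb' : (b : ℝ) ≠ 0 := by positivity
  have hsum := sum_combo_eq_sum_add_finsum_gaps ha hb hab
    (fun k => (k / (a * b) : ℝ) * f (k / (a * b)))
  have hcombo : ∀ i j : ℕ, (((i * a + j * b : ℕ) : ℝ) / (a * b)) = i / b + j / a := by
    intro i j
    push_cast
    field_simp
  have hshift : ∀ k : ℕ, (((k + a * b : ℕ) : ℝ) / (a * b)) = k / (a * b) + 1 := by
    intro k
    push_cast
    field_simp
  simp only [hcombo, hshift] at hsum
  have hA : ∑ i ∈ Finset.range b, (i / b : ℝ) * f (i * a / b)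
      = αa * ∑ i ∈ Finset.range b, ∑ j ∈ Finset.range a, (i / b : ℝ) * f (i / b + j / a)
        + βa * ((b - 1) / 2) := by
    rw [← sum_range_cast_div hb, Finset.mul_sum, Finset.mul_sum, ← Finset.sum_add_distrib]
    refine Finset.sum_congr rfl fun i hi => ?_
    rw [hfa i hi, ← Finset.mul_sum]
    ring
  have hB : ∑ j ∈ Finset.range a, (j / a : ℝ) * f (j * b / a)
      = αb * ∑ i ∈ Finset.range b, ∑ j ∈ Finset.range a, (j / a : ℝ) * f (i / b + j / a)
        + βb * ((a - 1) / 2) := by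
    rw [← sum_range_cast_div ha, Finset.sum_comm, Finset.mul_sum, Finset.mul_sum,
      ← Finset.sum_add_distrib]
    refine Finset.sum_congr rfl fun j hj => ?_
    rw [hfb j hj, ← Finset.mul_sum]
    ring
  simp only [add_mul (_ / (b : ℝ)) (_ / (a : ℝ)), Finset.sum_add_distrib] at hsum
  rw [hA, hB]
  linear_combination αa * αb * hsum
end

section
/- Let a, b be coprime positive integers, h : ℝ → ℝ any function, and λ, μ real numbers. Then λ · ∑_{k=0}^{b−1} (k·a/b) h(k·a/b) + μ · ∑_{k=0}^{a−1} (k·b/a) h(k·b/a) = λ · ∑_{k=0}^{b−1} (k/b) h(k/b) + μ · ∑_{k=0}^{a−1} (k/a) h(k/a) + λ · ∑_{k ∈ C_{a,b}} ( (k/b + 1) h(k/b + 1) − (k/b) h(k/b) ) + μ · ∑_{k ∈ C_{a,b}} ( (k/a + 1) h(k/a + 1) − (k/a) h(k/a) ). -/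
theorem bijOn_mul_mod {a b : ℕ} (hb : 0 < b) (hab : Nat.Coprime a b) :
    Set.BijOn (fun k => k * a % b) (Finset.range b) (Finset.range b) := by
  have hmaps : Set.MapsTo (fun k => k * a % b) (Finset.range b) (Finset.range b) :=
    fun k _ => by simpa using Nat.mod_lt _ hb
  have hinj : Set.InjOn (fun k => k * a % b) (Finset.range b) := by
    intro k hk l hl hkl
    have h : k ≡ l [MOD b] := Nat.ModEq.cancel_right_of_coprime hab.symm hkl
    exact h.eq_of_lt_of_lt (by simpa using hk) (by simpa using hl)
  exact ⟨hmaps, hinj, Finset.surjOn_of_injOn_of_card_le _ hmaps hinj le_rfl⟩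

/-- Every gap is uniquely `k * a % b + j * b` with `k < b` and `j < k * a / b`. -/
theorem bijOn_gaps {a b : ℕ} (hb : 0 < b) (hab : Nat.Coprime a b) :
    Set.BijOn (fun p : (_ : ℕ) × ℕ => p.1 * a % b + p.2 * b)
      ((Finset.range b).sigma fun k => Finset.range (k * a / b)) (gaps a b) := by
  refine ⟨?_, ?_, ?_⟩
  · rintro ⟨k, j⟩ hp ⟨i, l, hil⟩
    simp only [Finset.coe_sigma, Set.mem_sigma_iff, Finset.mem_coe, Finset.mem_range] at hp hil
    have hmod : i ≡ k [MOD b] := by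
      refine Nat.ModEq.cancel_right_of_coprime hab.symm ?_
      have := congrArg (· % b) hil
      simpa [Nat.ModEq, eq_comm] using this
    have hki : k ≤ i := by
      rw [← Nat.mod_eq_of_lt hp.1, ← hmod]
      exact Nat.mod_le _ _
    have h1 : k * a ≤ i * a := Nat.mul_le_mul_right a hki
    have h2 : (j + 1) * b ≤ k * a / b * b := Nat.mul_le_mul_right b hp.2
    have h3 := Nat.mod_add_div' (k * a) b
    rw [add_mul] at h2
    omega
  · rintro ⟨k, j⟩ hp ⟨k', j'⟩ hp' heq
    simp only [Finset.coe_sigma, Set.mem_sigma_iff, Finset.mem_coe, Finset.mem_range]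
      at hp hp' heq
    have hk : k = k' := (bijOn_mul_mod hb hab).injOn (by simpa using hp.1) (by simpa using hp'.1)
      (by simpa using congrArg (· % b) heq)
    subst hk
    have hj : j = j' := Nat.eq_of_mul_eq_mul_right hb (Nat.add_left_cancel heq)
    rw [hj]
  · intro n hn
    obtain ⟨k, hk, hkn⟩ := (bijOn_mul_mod hb hab).surjOn
      (show n % b ∈ (Finset.range b : Set ℕ) by simpa using Nat.mod_lt _ hb)
    simp only [Finset.mem_coe, Finset.mem_range] at hk hkn
    have h1 := Nat.mod_add_div' n b
    have h2 := Nat.mod_add_div' (k * a) b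
    refine ⟨⟨k, n / b⟩, ?_, by simp only [hkn, h1]⟩
    simp only [Finset.coe_sigma, Set.mem_sigma_iff, Finset.mem_coe, Finset.mem_range]
    refine ⟨hk, ?_⟩
    by_contra! hle
    refine hn ⟨k, n / b - k * a / b, ?_⟩
    have h3 := Nat.mul_le_mul_right b hle
    rw [Nat.sub_mul]
    omega

theorem gaps_comm (a b : ℕ) : gaps a b = gaps b a := by
  ext n
  refine not_congr ⟨?_, ?_⟩ <;>
    exact fun ⟨i, j, h⟩ => ⟨j, i, h.trans (add_comm _ _)⟩

theorem sum_range_mul_eq_add_finsum_gaps {M : Type*} [AddCommGroup M] {a b : ℕ} (hb : 0 < b)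
    (hab : Nat.Coprime a b) (f : ℕ → M) :
    ∑ k ∈ Finset.range b, f (k * a)
      = ∑ k ∈ Finset.range b, f k + ∑ᶠ k ∈ gaps a b, (f (k + b) - f k) := by
  have hgaps : ∑ᶠ n ∈ gaps a b, (f (n + b) - f n)
      = ∑ k ∈ Finset.range b, (f (k * a) - f (k * a % b)) := by
    rw [← finsum_mem_eq_of_bijOn _ (bijOn_gaps hb hab) fun _ _ => rfl, finsum_mem_coe_finset,
      Finset.sum_sigma]
    refine Finset.sum_congr rfl fun k _ => ?_
    have := Finset.sum_range_sub (fun j => f (k * a % b + j * b)) (k * a / b)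
    simpa only [add_mul, one_mul, zero_mul, add_zero, add_assoc, Nat.mod_add_div'] using this
  have hperm : ∑ k ∈ Finset.range b, f (k * a % b) = ∑ k ∈ Finset.range b, f k := by
    have h := bijOn_mul_mod hb hab
    exact Finset.sum_nbij _ h.mapsTo h.injOn h.surjOn fun _ _ => rfl
  rw [hgaps, Finset.sum_sub_distrib, hperm, add_sub_cancel]

theorem sum_range_mul_div_eq {a b : ℕ} (hb : 0 < b) (hab : Nat.Coprime a b) (h : ℝ → ℝ) :
    ∑ k ∈ Finset.range b, (k * a / b : ℝ) * h (k * a / b)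
      = ∑ k ∈ Finset.range b, (k / b : ℝ) * h (k / b)
        + ∑ᶠ k ∈ gaps a b, ((k / b + 1) * h (k / b + 1) - k / b * h (k / b)) := by
  have hb' : (b : ℝ) ≠ 0 := by exact_mod_cast hb.ne'
  simpa only [Nat.cast_mul, Nat.cast_add, add_div, div_self hb'] using
    sum_range_mul_eq_add_finsum_gaps hb hab fun n => (n / b : ℝ) * h (n / b)

theorem stmt_11 (a b : ℕ) (ha : 0 < a) (hb : 0 < b) (hab : Nat.Coprime a b)
    (h : ℝ → ℝ) (lam mu : ℝ) :
    lam * (∑ k ∈ Finset.range b, (k * a / b : ℝ) * h (k * a / b))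
      + mu * (∑ k ∈ Finset.range a, (k * b / a : ℝ) * h (k * b / a))
      = lam * (∑ k ∈ Finset.range b, (k / b : ℝ) * h (k / b))
        + mu * (∑ k ∈ Finset.range a, (k / a : ℝ) * h (k / a))
        + lam * (∑ᶠ k ∈ gaps a b, ((k / b + 1) * h (k / b + 1) - k / b * h (k / b)))
        + mu * (∑ᶠ k ∈ gaps a b, ((k / a + 1) * h (k / a + 1) - k / a * h (k / a))) := by
  rw [sum_range_mul_div_eq hb hab h, sum_range_mul_div_eq ha hab.symm h, gaps_comm b a]
  ring
end

section
/- Let a, b be coprime positive integers, n ≥ 1 an integer, and x a real number. Then ∑_{i=1}^{b−1} ∑_{j=1}^{a−1} (x/(ab) + j/a + i/b)^n = x^n/(ab)^n − (B_{n+1}(x/a + b) − B_{n+1}(x/a))/(b^n (n+1)) − (B_{n+1}(x/b + a) − B_{n+1}(x/b))/(a^n (n+1)) + (B_{n+1}(x + ab) − B_{n+1}(x))/((ab)^n (n+1)) + (1/(ab)^n) · ∑_{i=0}^{n} C(n,i) ((x + ab)^{n−i} − x^{n−i}) S_{a,b}(i). -/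
/-- The `n`-th Bernoulli polynomial, as a real function:
`B_n(x) = ∑_{i=0}^n C(n,i) B_i x^(n-i)`. -/
noncomputable def bernoulliPoly (n : ℕ) (x : ℝ) : ℝ :=
  ∑ i ∈ Finset.range (n + 1), (n.choose i : ℝ) * (bernoulli i : ℝ) * x ^ (n - i)

/-- The Sylvester sums `S_{a,b}(m) = ∑_{k ∈ C_{a,b}} k^m`. -/
noncomputable def sylvester (a b m : ℕ) : ℝ :=
  ∑ᶠ k ∈ gaps a b, (k : ℝ) ^ m

theorem bernoulliPoly_eq_eval (n : ℕ) (x : ℝ) :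
    bernoulliPoly n x = ((Polynomial.bernoulli n).map (algebraMap ℚ ℝ)).eval x := by
  rw [bernoulliPoly, Polynomial.bernoulli_def, Polynomial.map_sum, Polynomial.eval_finsetSum,
    ← Finset.sum_range_reflect]
  refine Finset.sum_congr rfl fun i hi => ?_
  have hi' : i ≤ n := by simpa [Nat.lt_succ_iff] using hi
  have h : n + 1 - 1 - i = n - i := by omega
  simp only [h, Polynomial.map_monomial, Polynomial.eval_monomial, Nat.sub_sub_self hi',
    Nat.choose_symm hi']
  rw [map_mul, map_natCast, eq_ratCast]
  ring

theorem bernoulliPoly_add_one (n : ℕ) (x : ℝ) :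
    bernoulliPoly (n + 1) (x + 1) = bernoulliPoly (n + 1) x + (n + 1) * x ^ n := by
  have h := congrArg (fun p => (p.map (algebraMap ℚ ℝ)).eval x)
    (Polynomial.bernoulli_comp_one_add_X (n + 1))
  simp only [Polynomial.map_comp, Polynomial.eval_comp] at h
  rw [bernoulliPoly_eq_eval, bernoulliPoly_eq_eval, add_comm x 1]
  simpa using h

theorem bernoulliPoly_add_natCast_sub (n m : ℕ) (x : ℝ) :
    bernoulliPoly (n + 1) (x + m) - bernoulliPoly (n + 1) x
      = (n + 1) * ∑ k ∈ Finset.range m, (x + k) ^ n := by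
  induction m with
  | zero => simp
  | succ m ih =>
    rw [Finset.sum_range_succ, mul_add, ← ih, Nat.cast_succ, ← add_assoc, bernoulliPoly_add_one]
    ring

/-- A first coordinate below `b` is minimal among representations in the same residue class. -/
theorem le_of_mul_add_mul_modEq {a b i j i' j' : ℕ} (hab : Nat.Coprime a b) (hi : i < b)
    (h : i * a + j * b ≡ i' * a + j' * b [MOD a * b]) : i ≤ i' := by
  have h₁ : i * a ≡ i' * a [MOD b] := by
    have := h.of_mul_left a
    simpa [Nat.ModEq] using this
  have h₂ : i ≡ i' [MOD b] := Nat.ModEq.cancel_right_of_coprime hab.symm h₁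
  rw [← Nat.mod_eq_of_lt hi, h₂]
  exact Nat.mod_le _ _

/-- The counterpart of `le_of_mul_add_mul_modEq` for the second coordinate. -/
theorem le_of_mul_add_mul_modEq' {a b i j i' j' : ℕ} (hab : Nat.Coprime a b) (hj : j < a)
    (h : i * a + j * b ≡ i' * a + j' * b [MOD a * b]) : j ≤ j' := by
  refine le_of_mul_add_mul_modEq (i := j) (j := i) (j' := i') hab.symm hj ?_
  rwa [add_comm (j * b), add_comm (j' * b), mul_comm b a]

theorem sub_mem_gaps {a b i j : ℕ} (hab : Nat.Coprime a b) (hi : i < b) (hj : j < a)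
    (h : a * b ≤ i * a + j * b) : i * a + j * b - a * b ∈ gaps a b := by
  rintro ⟨i', j', h'⟩
  have hm : i * a + j * b ≡ i' * a + j' * b [MOD a * b] := by
    rw [← h']
    exact (Nat.modEq_iff_dvd' (Nat.sub_le _ _)).2 (by rw [Nat.sub_sub_self h]) |>.symm
  have h₁ := Nat.mul_le_mul_right a (le_of_mul_add_mul_modEq hab hi hm)
  have h₂ := Nat.mul_le_mul_right b (le_of_mul_add_mul_modEq' hab hj hm)
  have : 0 < a * b := Nat.mul_pos (by omega) (by omega)
  omega

theorem lt_mul_of_mem_gaps {a b k : ℕ} (hab : Nat.Coprime a b)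
    (hk : k ∈ gaps a b) : k < a * b := by
  by_contra! h
  obtain ⟨i, j, hij⟩ := Nat.exists_add_mul_eq_of_gcd_dvd_of_mul_pred_le a b k
    (by simp [hab.gcd_eq_one]) ((Nat.mul_le_mul (Nat.pred_le a) (Nat.pred_le b)).trans h)
  exact hk ⟨i, j, hij.symm⟩

open Classical in
/-- Summing over a box of lattice points visits each residue modulo `a * b` once, at its least
representative unless that is a gap, and then one period higher. -/
theorem sum_lattice_eq {M : Type*} [AddCommMonoid M] {a b : ℕ} (ha : 0 < a) (hb : 0 < b)
    (hab : Nat.Coprime a b) (f : ℕ → M) :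
    ∑ i ∈ Finset.range b, ∑ j ∈ Finset.range a, f (i * a + j * b)
      = ∑ k ∈ Finset.range (a * b), if k ∈ gaps a b then f (k + a * b) else f k := by
  have hpos : 0 < a * b := Nat.mul_pos ha hb
  rw [← Finset.sum_product']
  have hmaps : ∀ p ∈ Finset.range b ×ˢ Finset.range a,
      (p.1 * a + p.2 * b) % (a * b) ∈ Finset.range (a * b) :=
    fun p _ => Finset.mem_range.2 (Nat.mod_lt _ hpos)
  have hinj : Set.InjOn (fun p : ℕ × ℕ => (p.1 * a + p.2 * b) % (a * b))
      (Finset.range b ×ˢ Finset.range a : Finset (ℕ × ℕ)) := by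
    rintro ⟨i, j⟩ hp ⟨i', j'⟩ hq h
    simp only [Finset.coe_product, Finset.coe_range, Set.mem_prod, Set.mem_Iio] at hp hq
    exact Prod.ext
      (le_antisymm (le_of_mul_add_mul_modEq hab hp.1 h)
        (le_of_mul_add_mul_modEq hab hq.1 (Nat.ModEq.symm h)))
      (le_antisymm (le_of_mul_add_mul_modEq' hab hp.2 h)
        (le_of_mul_add_mul_modEq' hab hq.2 (Nat.ModEq.symm h)))
  refine Finset.sum_nbij _ hmaps hinj
    (Finset.surjOn_of_injOn_of_card_le _ hmaps hinj (by simp [mul_comm])) ?_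
  rintro ⟨i, j⟩ hp
  simp only [Finset.mem_product, Finset.mem_range] at hp
  dsimp only
  rcases lt_or_ge (i * a + j * b) (a * b) with h | h
  · rw [Nat.mod_eq_of_lt h, if_neg]
    exact fun hg => hg ⟨i, j, rfl⟩
  · have hlt : i * a + j * b - a * b < a * b := by
      have h₁ := Nat.mul_lt_mul_of_pos_right hp.1 ha
      have h₂ := Nat.mul_lt_mul_of_pos_right hp.2 hb
      rw [mul_comm b a] at h₁
      omega
    rw [Nat.mod_eq_sub_mod h, Nat.mod_eq_of_lt hlt, if_pos (sub_mem_gaps hab hp.1 hp.2 h),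
      Nat.sub_add_cancel h]

open Classical in
theorem sylvester_eq_sum {a b : ℕ} (hab : Nat.Coprime a b) (m : ℕ) :
    sylvester a b m = ∑ k ∈ Finset.range (a * b) with k ∈ gaps a b, (k : ℝ) ^ m := by
  rw [sylvester, ← finsum_mem_coe_finset]
  congr! 3 with k
  simpa using lt_mul_of_mem_gaps hab

open Classical in
theorem sum_choose_mul_sylvester {a b : ℕ} (hab : Nat.Coprime a b)
    (n : ℕ) (x y : ℝ) :
    ∑ i ∈ Finset.range (n + 1), (n.choose i : ℝ) * (y ^ (n - i) - x ^ (n - i)) * sylvester a b i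
      = ∑ k ∈ Finset.range (a * b) with k ∈ gaps a b, ((y + k) ^ n - (x + k) ^ n) := by
  simp only [sylvester_eq_sum hab, Finset.mul_sum]
  rw [Finset.sum_comm]
  refine Finset.sum_congr rfl fun k _ => ?_
  rw [add_comm y, add_comm x, add_pow, add_pow, ← Finset.sum_sub_distrib]
  exact Finset.sum_congr rfl fun i _ => by ring

theorem sum_sum_Icc_one_pred {M : Type*} [AddCommGroup M] {a b : ℕ} (ha : 0 < a) (hb : 0 < b)
    (g : ℕ → ℕ → M) :
    ∑ i ∈ Finset.Icc 1 (b - 1), ∑ j ∈ Finset.Icc 1 (a - 1), g i j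
      = ∑ i ∈ Finset.range b, ∑ j ∈ Finset.range a, g i j
        - ∑ i ∈ Finset.range b, g i 0 - ∑ j ∈ Finset.range a, g 0 j + g 0 0 := by
  have key : ∀ {c : ℕ}, 0 < c → ∀ h : ℕ → M,
      ∑ i ∈ Finset.Icc 1 (c - 1), h i = ∑ i ∈ Finset.range c, h i - h 0 := by
    intro c hc h
    obtain ⟨c, rfl⟩ := Nat.exists_eq_succ_of_ne_zero hc.ne'
    rw [Finset.sum_range_eq_add_Ico _ hc, add_sub_cancel_left]
    rfl
  rw [key hb]
  simp only [key ha, Finset.sum_sub_distrib]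
  abel
theorem stmt_14 (a b n : ℕ) (ha : 0 < a) (hb : 0 < b) (hab : Nat.Coprime a b)
    (hn : 1 ≤ n) (x : ℝ) :
    ∑ i ∈ Finset.Icc 1 (b - 1), ∑ j ∈ Finset.Icc 1 (a - 1),
        (x / (a * b) + j / a + i / b) ^ n
      = x ^ n / (a * b : ℝ) ^ n
        - (bernoulliPoly (n + 1) (x / a + b) - bernoulliPoly (n + 1) (x / a))
            / ((b : ℝ) ^ n * (n + 1))
        - (bernoulliPoly (n + 1) (x / b + a) - bernoulliPoly (n + 1) (x / b))
            / ((a : ℝ) ^ n * (n + 1))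
        + (bernoulliPoly (n + 1) (x + a * b) - bernoulliPoly (n + 1) x)
            / ((a * b : ℝ) ^ n * (n + 1))
        + (1 / (a * b : ℝ) ^ n) * ∑ i ∈ Finset.range (n + 1),
            (n.choose i : ℝ) * ((x + a * b) ^ (n - i) - x ^ (n - i)) * sylvester a b i := by
  classical
  have ha' : (a : ℝ) ≠ 0 := by positivity
  have hb' : (b : ℝ) ≠ 0 := by positivity
  have hn' : (n + 1 : ℝ) ≠ 0 := by positivity
  have hx : bernoulliPoly (n + 1) (x + a * b) - bernoulliPoly (n + 1) x
      = (n + 1) * ∑ k ∈ Finset.range (a * b), (x + k) ^ n := by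
    rw [← bernoulliPoly_add_natCast_sub, Nat.cast_mul]
  have hL := sum_lattice_eq ha hb hab fun k => (x + k : ℝ) ^ n
  have hsplit : (∑ k ∈ Finset.range (a * b),
        if k ∈ gaps a b then (x + (k + a * b : ℕ) : ℝ) ^ n else (x + k) ^ n)
      = ∑ k ∈ Finset.range (a * b), (x + k) ^ n
        + ∑ k ∈ Finset.range (a * b) with k ∈ gaps a b,
            ((x + a * b + k) ^ n - (x + k) ^ n) := by
    rw [Finset.sum_filter, ← Finset.sum_add_distrib]
    refine Finset.sum_congr rfl fun k _ => ?_
    split_ifs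
    · push_cast
      ring
    · ring
  have hterm : ∀ i j : ℕ, (x / (a * b) + j / a + i / b : ℝ) ^ n
      = (x + (i * a + j * b : ℕ)) ^ n / (a * b) ^ n := by
    intro i j
    rw [← div_pow]
    congr 1
    push_cast
    field_simp
    ring
  have hA : ∀ k : ℕ, (x / a + k : ℝ) ^ n = (x + k * a) ^ n / a ^ n := by
    intro k
    rw [← div_pow]
    congr 1
    field_simp
  have hB : ∀ k : ℕ, (x / b + k : ℝ) ^ n = (x + k * b) ^ n / b ^ n := by
    intro k
    rw [← div_pow]
    congr 1
    field_simp
  rw [bernoulliPoly_add_natCast_sub, bernoulliPoly_add_natCast_sub, hx,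
    sum_choose_mul_sylvester hab]
  simp only [hterm, hA, hB, ← Finset.sum_div]
  rw [sum_sum_Icc_one_pred ha hb fun i j => (x + (i * a + j * b : ℕ) : ℝ) ^ n, hL, hsplit]
  simp only [Nat.zero_mul, Nat.zero_add, Nat.cast_mul, Nat.cast_zero, add_zero]
  field_simp
  ring
end

section
/- Let a, b be coprime positive integers. Then ∑_{i=1}^{b−1} ∑_{j=1}^{a−1} ( 2·|j/a + i/b − 1| − 1 ) = −(1/3)·(a − 1/a)·(b − 1/b). -/
theorem sum_range_natCast (n : ℕ) : ∑ r ∈ Finset.range n, (r : ℝ) = n * (n - 1) / 2 := by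
  induction n with
  | zero => simp
  | succ k ih => rw [Finset.sum_range_succ, ih]; push_cast; ring

theorem sum_range_natCast_sq (n : ℕ) :
    ∑ r ∈ Finset.range n, (r : ℝ) ^ 2 = (n - 1) * n * (2 * n - 1) / 6 := by
  induction n with
  | zero => simp
  | succ k ih => rw [Finset.sum_range_succ, ih]; push_cast; ring

theorem sum_Icc_one_pred (f : ℕ → ℝ) {n : ℕ} (hn : 0 < n) :
    ∑ i ∈ Finset.Icc 1 (n - 1), f i = ∑ i ∈ Finset.range n, f i - f 0 := by
  have h : Finset.range n = insert 0 (Finset.Icc 1 (n - 1)) := by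
    ext x
    simp only [Finset.mem_range, Finset.mem_insert, Finset.mem_Icc]
    omega
  rw [h, Finset.sum_insert (by simp)]
  ring

/-- As `(i, j)` runs over `[0, b) × [0, a)`, the residue of `a * i + b * j` modulo `a * b`
takes every value exactly once. -/
theorem sum_range_mod_mul_of_coprime {a b : ℕ} (ha : 0 < a) (hb : 0 < b) (hab : Nat.Coprime a b)
    (g : ℕ → ℝ) :
    ∑ i ∈ Finset.range b, ∑ j ∈ Finset.range a, g ((a * i + b * j) % (a * b)) =
      ∑ r ∈ Finset.range (a * b), g r := by
  have hinj : Set.InjOn (fun p : ℕ × ℕ => (a * p.1 + b * p.2) % (a * b))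
      (Finset.range b ×ˢ Finset.range a : Finset (ℕ × ℕ)) := by
    rintro ⟨i, j⟩ hp ⟨i', j'⟩ hq h
    simp only [Finset.coe_product, Finset.coe_range, Set.mem_prod, Set.mem_Iio] at hp hq
    have h' : a * i + b * j ≡ a * i' + b * j' [MOD a * b] := h
    have h1 : a * i ≡ a * i' [MOD b] := by
      simpa [Nat.ModEq, Nat.add_mul_mod_self_left] using h'.of_mul_left a
    have h2 : b * j ≡ b * j' [MOD a] := by
      simpa [Nat.ModEq, Nat.mul_add_mod] using h'.of_mul_right b
    have e1 := (Nat.ModEq.cancel_left_of_coprime hab.symm h1).eq_of_lt_of_lt hp.1 hq.1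
    have e2 := (Nat.ModEq.cancel_left_of_coprime hab h2).eq_of_lt_of_lt hp.2 hq.2
    rw [e1, e2]
  have himage : (Finset.range b ×ˢ Finset.range a).image
      (fun p : ℕ × ℕ => (a * p.1 + b * p.2) % (a * b)) = Finset.range (a * b) := by
    apply Finset.eq_of_subset_of_card_le
    · intro r hr
      obtain ⟨p, -, rfl⟩ := Finset.mem_image.1 hr
      exact Finset.mem_range.2 (Nat.mod_lt _ (Nat.mul_pos ha hb))
    · rw [Finset.card_image_of_injOn hinj]
      simp [mul_comm]
  rw [← himage, Finset.sum_image hinj, Finset.sum_product]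

theorem abs_sub_one_eq_sq_add {a b i j : ℕ} (hi : i < b) (hj : j < a) :
    |(j : ℝ) / a + i / b - 1| = ((j : ℝ) / a + i / b - 1) ^ 2 +
      (((a * i + b * j) % (a * b) : ℕ) : ℝ) / (a * b) *
        (1 - (((a * i + b * j) % (a * b) : ℕ) : ℝ) / (a * b)) := by
  have ha : (0 : ℝ) < a := by exact_mod_cast Nat.zero_lt_of_lt hj
  have hb : (0 : ℝ) < b := by exact_mod_cast Nat.zero_lt_of_lt hi
  have hx : (j : ℝ) / a + i / b = ((a * i + b * j : ℕ) : ℝ) / (a * b) := by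
    push_cast
    field_simp
    ring
  have h1 : a * i < a * b := Nat.mul_lt_mul_of_pos_left hi (Nat.zero_lt_of_lt hj)
  have h2 : b * j < a * b := by
    rw [mul_comm a b]; exact Nat.mul_lt_mul_of_pos_left hj (Nat.zero_lt_of_lt hi)
  rw [hx]
  rcases lt_or_ge (a * i + b * j) (a * b) with h | h
  · rw [Nat.mod_eq_of_lt h, abs_of_nonpos]
    · ring
    · rw [sub_nonpos, div_le_one (by positivity)]
      exact_mod_cast h.le
  · rw [Nat.mod_eq_sub_mod h, Nat.mod_eq_of_lt (by omega), Nat.cast_sub h, abs_of_nonneg]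
    · push_cast
      field_simp
      ring
    · rw [sub_nonneg, one_le_div (by positivity)]
      exact_mod_cast h

theorem sum_range_abs_sub_one {a b : ℕ} (ha : 0 < a) (hb : 0 < b) (hab : Nat.Coprime a b) :
    ∑ i ∈ Finset.range b, ∑ j ∈ Finset.range a, |(j : ℝ) / a + i / b - 1| =
      ∑ i ∈ Finset.range b, ∑ j ∈ Finset.range a, ((j : ℝ) / a + i / b - 1) ^ 2 +
        ∑ r ∈ Finset.range (a * b), (r : ℝ) / (a * b) * (1 - (r : ℝ) / (a * b)) := by
  rw [← sum_range_mod_mul_of_coprime ha hb hab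
    (fun r => (r : ℝ) / (a * b) * (1 - (r : ℝ) / (a * b)))]
  simp only [← Finset.sum_add_distrib]
  exact Finset.sum_congr rfl fun i hi => Finset.sum_congr rfl fun j hj =>
    abs_sub_one_eq_sq_add (Finset.mem_range.1 hi) (Finset.mem_range.1 hj)

theorem sum_range_div_mul_one_sub_div {n : ℕ} (hn : 0 < n) :
    ∑ r ∈ Finset.range n, (r : ℝ) / n * (1 - (r : ℝ) / n) = ((n : ℝ) ^ 2 - 1) / (6 * n) := by
  have hn' : (n : ℝ) ≠ 0 := by positivity
  have h (r : ℕ) : (r : ℝ) / n * (1 - (r : ℝ) / n) = r * (1 / n) - r ^ 2 * (1 / n ^ 2) := by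
    ring
  simp only [h, Finset.sum_sub_distrib, ← Finset.sum_mul, sum_range_natCast,
    sum_range_natCast_sq]
  field_simp
  ring

theorem sum_range_abs_div_sub_one {n : ℕ} (hn : 0 < n) :
    ∑ r ∈ Finset.range n, |(r : ℝ) / n - 1| = ((n : ℝ) + 1) / 2 := by
  have hn' : (0 : ℝ) < n := by positivity
  have h : ∀ r ∈ Finset.range n, |(r : ℝ) / n - 1| = 1 - r * (1 / n) := by
    intro r hr
    rw [abs_of_nonpos]
    · ring
    · rw [sub_nonpos, div_le_one hn']
      exact_mod_cast (Finset.mem_range.1 hr).le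
  rw [Finset.sum_congr rfl h, Finset.sum_sub_distrib, ← Finset.sum_mul, sum_range_natCast]
  simp only [Finset.sum_const, Finset.card_range, nsmul_eq_mul]
  field_simp
  ring

theorem sum_range_sq_sub_one {a b : ℕ} (ha : 0 < a) (hb : 0 < b) :
    ∑ i ∈ Finset.range b, ∑ j ∈ Finset.range a, ((j : ℝ) / a + i / b - 1) ^ 2 =
      (b : ℝ) * ((a - 1) * (2 * a - 1) / (6 * a)) + a * ((b - 1) * (2 * b - 1) / (6 * b))
        + a * b + (a - 1) * (b - 1) / 2 - b * (a - 1) - a * (b - 1) := by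
  have ha' : (a : ℝ) ≠ 0 := by positivity
  have hb' : (b : ℝ) ≠ 0 := by positivity
  have h (i j : ℕ) : ((j : ℝ) / a + i / b - 1) ^ 2 =
      (j : ℝ) ^ 2 * (1 / a ^ 2) + j * (2 * (i / b - 1) / a) + (i / b - 1) ^ 2 := by ring
  have h' (i : ℕ) : ∑ j ∈ Finset.range a, ((j : ℝ) / a + i / b - 1) ^ 2 =
      (i : ℝ) ^ 2 * (a / b ^ 2) + i * ((a - 1) / b - 2 * a / b)
        + ((a - 1) * (2 * a - 1) / (6 * a) + 1) := by
    simp only [h, Finset.sum_add_distrib, ← Finset.sum_mul, sum_range_natCast,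
      sum_range_natCast_sq, Finset.sum_const, Finset.card_range, nsmul_eq_mul]
    field_simp
    ring
  simp only [h', Finset.sum_add_distrib, ← Finset.sum_mul, sum_range_natCast,
    sum_range_natCast_sq, Finset.sum_const, Finset.card_range, nsmul_eq_mul]
  field_simp
  ring

theorem stmt_16 (a b : ℕ) (ha : 0 < a) (hb : 0 < b) (hab : Nat.Coprime a b) :
    ∑ i ∈ Finset.Icc 1 (b - 1), ∑ j ∈ Finset.Icc 1 (a - 1),
        (2 * |(j : ℝ) / a + i / b - 1| - 1)
      = -(1 / 3) * ((a : ℝ) - 1 / a) * ((b : ℝ) - 1 / b) := by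
  have ha' : (a : ℝ) ≠ 0 := by positivity
  have hb' : (b : ℝ) ≠ 0 := by positivity
  have hr := sum_range_div_mul_one_sub_div (Nat.mul_pos ha hb)
  push_cast at hr
  simp only [sum_Icc_one_pred _ ha, sum_Icc_one_pred _ hb, Finset.sum_sub_distrib,
    ← Finset.mul_sum, sum_range_abs_sub_one ha hb hab, hr, sum_range_sq_sub_one ha hb,
    Nat.cast_zero, zero_div, zero_add, add_zero, sum_range_abs_div_sub_one ha,
    sum_range_abs_div_sub_one hb, Finset.sum_const, Finset.card_range, nsmul_eq_mul]
  norm_num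
  field_simp
  ring
end

section
/- Let a, b be coprime positive integers and let f : ℕ → ℝ be any function. Then ∑_{i=1}^{b−1} ∑_{j=1}^{a−1} f(i·a + j·b) = ∑_{(i,j) ∈ T} f(i·a + j·b) + ∑_{(i,j) ∈ T} f(2ab − i·a − j·b), where T = { (i,j) : 0 < i < b, 0 < j < a, i·a + j·b < ab }. -/
/-- The set of pairs `(i,j)` with `0 < i < b`, `0 < j < a` and `i*a + j*b < a*b`. -/
def T (a b : ℕ) : Finset (ℕ × ℕ) :=
  (Finset.Ioo 0 b ×ˢ Finset.Ioo 0 a).filter (fun p => p.1 * a + p.2 * b < a * b)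

/-- For coprime `a` and `b`, no pair `(i, j)` with `0 < j < a` lies on the line
`i * a + j * b = a * b`. -/
theorem mul_add_mul_ne_mul_of_coprime {a b i j : ℕ} (hab : Nat.Coprime a b)
    (hj : 0 < j) (hja : j < a) : i * a + j * b ≠ a * b := by
  intro h
  have hdvd : a ∣ j * b :=
    (Nat.dvd_add_right (Dvd.intro_left i rfl)).1 (h ▸ Dvd.intro b rfl)
  exact absurd (Nat.le_of_dvd hj (hab.dvd_of_dvd_mul_right hdvd)) (not_le.2 hja)

/-- The point reflection `(i, j) ↦ (b - i, a - j)` sends the value `i * a + j * b` to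
`2 * (a * b) - i * a - j * b`. -/
theorem reflect_mul_add_mul {a b i j : ℕ} (hi : i ≤ b) (hj : j ≤ a) :
    (b - i) * a + (a - j) * b = 2 * (a * b) - i * a - j * b := by
  have h₁ : i * a ≤ b * a := Nat.mul_le_mul_right a hi
  have h₂ : j * b ≤ a * b := Nat.mul_le_mul_right b hj
  rw [Nat.sub_mul, Nat.sub_mul]
  rw [Nat.mul_comm b a] at h₁ ⊢
  omega

theorem stmt_18 (a b : ℕ) (ha : 0 < a) (hb : 0 < b) (hab : Nat.Coprime a b)
    (f : ℕ → ℝ) :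
    ∑ i ∈ Finset.Icc 1 (b - 1), ∑ j ∈ Finset.Icc 1 (a - 1), f (i * a + j * b)
      = (∑ p ∈ T a b, f (p.1 * a + p.2 * b))
        + ∑ p ∈ T a b, f (2 * (a * b) - p.1 * a - p.2 * b) := by
  have hIcc (n : ℕ) : Finset.Icc 1 (n - 1) = Finset.Ioo 0 n := by
    ext x
    simp only [Finset.mem_Icc, Finset.mem_Ioo]
    omega
  rw [hIcc, hIcc, ← Finset.sum_product' (f := fun i j => f (i * a + j * b)),
    ← Finset.sum_filter_add_sum_filter_not _ (fun p : ℕ × ℕ => p.1 * a + p.2 * b < a * b)]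
  congr 1
  symm
  refine Finset.sum_nbij' (fun p => (b - p.1, a - p.2)) (fun p => (b - p.1, a - p.2))
    ?_ ?_ ?_ ?_ ?_
  · rintro ⟨i, j⟩ h
    simp only [T, Finset.mem_filter, Finset.mem_product, Finset.mem_Ioo] at h ⊢
    have := reflect_mul_add_mul h.1.1.2.le h.1.2.2.le
    omega
  · rintro ⟨i, j⟩ h
    simp only [T, Finset.mem_filter, Finset.mem_product, Finset.mem_Ioo] at h ⊢
    have := reflect_mul_add_mul h.1.1.2.le h.1.2.2.le
    have := mul_add_mul_ne_mul_of_coprime (i := i) hab h.1.2.1 h.1.2.2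
    have : 0 < a * b := Nat.mul_pos ha hb
    omega
  · rintro ⟨i, j⟩ h
    simp only [T, Finset.mem_filter, Finset.mem_product, Finset.mem_Ioo] at h
    simp only [Nat.sub_sub_self h.1.1.2.le, Nat.sub_sub_self h.1.2.2.le]
  · rintro ⟨i, j⟩ h
    simp only [Finset.mem_filter, Finset.mem_product, Finset.mem_Ioo] at h
    simp only [Nat.sub_sub_self h.1.1.2.le, Nat.sub_sub_self h.1.2.2.le]
  · rintro ⟨i, j⟩ h
    simp only [T, Finset.mem_filter, Finset.mem_product, Finset.mem_Ioo] at h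
    rw [reflect_mul_add_mul h.1.1.2.le h.1.2.2.le]
end

section
/- Let a, b be coprime positive integers. Then C_{a,b} = { ab − i·a − j·b : 0 < i < b, 0 < j < a, i·a + j·b < ab }, i.e. the set of gaps of the numerical semigroup generated by a and b equals the set of numbers ab − ia − jb over integer pairs (i,j) with 0 < i < b, 0 < j < a and ia + jb < ab. -/
/-- Every residue class modulo `b` contains the negative of a multiple `i * a` with `i < b`. -/
theorem exists_lt_dvd_add_mul {a b : ℕ} (hb : 0 < b) (hab : Nat.Coprime a b) (n : ℕ) :
    ∃ i < b, b ∣ n + i * a := by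
  have : NeZero b := ⟨hb.ne'⟩
  refine ⟨(-(n : ZMod b) * (a : ZMod b)⁻¹).val, ZMod.val_lt _, ?_⟩
  rw [← ZMod.natCast_eq_zero_iff]
  push_cast
  rw [ZMod.natCast_zmod_val, mul_assoc, mul_comm _ (a : ZMod b), ZMod.coe_mul_inv_eq_one a hab]
  ring

/-- `a * b` is not a combination of `a` and `b` with positive coefficients. -/
theorem mul_add_mul_ne_mul_of_pos {a b x y : ℕ} (hab : Nat.Coprime a b)
    (hx : 0 < x) (hy : 0 < y) (hb : 0 < b) : x * a + y * b ≠ a * b := by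
  intro h
  have hdvd : b ∣ x * a :=
    (Nat.dvd_add_left (Dvd.intro_left y rfl)).1 (h ▸ Dvd.intro_left a rfl)
  have hle : b ≤ x := Nat.le_of_dvd hx (hab.symm.dvd_of_dvd_mul_right hdvd)
  nlinarith [Nat.mul_le_mul_right a hle, Nat.mul_pos hy hb]

theorem stmt_19 (a b : ℕ) (ha : 0 < a) (hb : 0 < b) (hab : Nat.Coprime a b) :
    gaps a b = {n | ∃ i j : ℕ, 0 < i ∧ i < b ∧ 0 < j ∧ j < a ∧
      i * a + j * b < a * b ∧ n = a * b - i * a - j * b} := by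
  ext n
  simp only [gaps, numSgp, Set.mem_compl_iff, Set.mem_ofPred_eq]
  constructor
  · intro hn
    obtain ⟨i, hib, k, hk⟩ := exists_lt_dvd_add_mul hb hab n
    have hn0 : 0 < n := by
      rcases Nat.eq_zero_or_pos n with rfl | h
      · exact absurd ⟨0, 0, by simp⟩ hn
      · exact h
    have hi : 0 < i := by
      rcases Nat.eq_zero_or_pos i with rfl | h
      · exact absurd ⟨0, k, by linarith⟩ hn
      · exact h
    have hk0 : 0 < k := by
      rcases Nat.eq_zero_or_pos k with rfl | h
      · omega
      · exact h
    have hka : k < a := by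
      by_contra! hle
      obtain ⟨c, rfl⟩ := Nat.exists_eq_add_of_le hle
      obtain ⟨d, rfl⟩ := Nat.exists_eq_add_of_lt hib
      exact hn ⟨d + 1, c, by linarith⟩
    obtain ⟨j, rfl⟩ := Nat.exists_eq_add_of_lt hka
    have heq : n + (i * (k + j + 1) + (j + 1) * b) = (k + j + 1) * b := by linarith
    exact ⟨i, j + 1, hi, hib, by omega, by omega, by omega, by omega⟩
  · rintro ⟨i, j, hi, -, hj, -, hlt, rfl⟩ ⟨x, y, hxy⟩
    refine mul_add_mul_ne_mul_of_pos (x := x + i) (y := y + j) hab (by omega) (by omega) hb ?_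
    rw [add_mul, add_mul]
    omega
end
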